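/- Let N ≥ 1 and m ≥ 2 be integers and let g : ℝ → ℝ be convex with g(s) ≥ 0 for all s ∈ ℝ. Suppose v : ℝ^N → ℝ is C^{2m}, v together with all its partial derivatives of order ≤ 2m is bounded on ℝ^N, and (−Δ)^m v(x) = g(v(x)) for all x ∈ ℝ^N. Then (−Δ)^l v(x) ≥ 0 for all x ∈ ℝ^N and all l = 1, …, m−1. -/

import Mathlib

noncomputable def lap {N : ℕ} (f : EuclideanSpace ℝ (Fin N) → ℝ)
    (x : EuclideanSpace ℝ (Fin N)) : ℝ :=
  ∑ i : Fin N, iteratedDeriv 2 (fun t : ℝ => f (x + t • EuclideanSpace.single i (1 : ℝ))) 0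

noncomputable def polyLap {N : ℕ} (m : ℕ) (f : EuclideanSpace ℝ (Fin N) → ℝ)
    (x : EuclideanSpace ℝ (Fin N)) : ℝ :=
  (-1 : ℝ) ^ m * (lap^[m] f x)

/-- The function `f` is `C^n` and its derivatives of order `≤ n` are bounded. -/
def HasBoundedDerivs {E : Type*} [NormedAddCommGroup E] [NormedSpace ℝ E] (n : ℕ)
    (f : E → ℝ) : Prop :=
  ContDiff ℝ n f ∧ ∀ j ≤ n, ∃ C : ℝ, ∀ x, ‖iteratedFDeriv ℝ j f x‖ ≤ C

namespace HasBoundedDerivs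

variable {E : Type*} [NormedAddCommGroup E] [NormedSpace ℝ E] {n : ℕ} {f : E → ℝ}

theorem fderiv_apply (hf : HasBoundedDerivs (n + 1) f) (e : E) :
    HasBoundedDerivs n (fun x => fderiv ℝ f x e) := by
  have hd : ContDiff ℝ n (fderiv ℝ f) :=
    hf.1.fderiv_right (m := n) (by norm_cast)
  refine ⟨hd.clm_apply contDiff_const, fun j hj => ?_⟩
  obtain ⟨C, hC⟩ := hf.2 (j + 1) (by omega)
  refine ⟨‖e‖ * C, fun x => ?_⟩
  refine (norm_iteratedFDeriv_clm_apply_const hd.contDiffAt (by exact_mod_cast hj)).trans ?_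
  rw [norm_iteratedFDeriv_fderiv]
  exact mul_le_mul_of_nonneg_left (hC x) (norm_nonneg e)

theorem sum {ι : Type*} (s : Finset ι) {f : ι → E → ℝ}
    (hf : ∀ i ∈ s, HasBoundedDerivs n (f i)) :
    HasBoundedDerivs n (fun x => ∑ i ∈ s, f i x) := by
  refine ⟨ContDiff.sum fun i hi => (hf i hi).1, fun j hj => ?_⟩
  choose! C hC using fun i hi => (hf i hi).2 j hj
  refine ⟨∑ i ∈ s, C i, fun x => ?_⟩
  rw [iteratedFDeriv_fun_sum_apply fun i hi =>
    ((hf i hi).1.of_le (by exact_mod_cast hj)).contDiffAt]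
  exact norm_sum_le_of_le _ fun i hi => hC i hi x

theorem exists_abs_le (hf : HasBoundedDerivs n f) : ∃ C : ℝ, ∀ x, |f x| ≤ C := by
  simpa using hf.2 0 (Nat.zero_le n)

end HasBoundedDerivs

/-- Second derivative test: at a global maximum the second derivative is nonpositive. -/
theorem iteratedDeriv_two_nonpos_of_forall_le {φ : ℝ → ℝ} {a : ℝ} (hφ : Continuous φ)
    (hmax : ∀ t, φ t ≤ φ a) : iteratedDeriv 2 φ a ≤ 0 := by
  by_contra! h
  rw [iteratedDeriv_succ, iteratedDeriv_one] at h
  have hloc : IsLocalMax φ a := Filter.Eventually.of_forall hmax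
  have hmin : IsLocalMin φ a :=
    isLocalMin_of_deriv_deriv_pos h hloc.deriv_eq_zero hφ.continuousAt
  have hconst : φ =ᶠ[nhds a] fun _ => φ a := by
    filter_upwards [hmin] with t ht using le_antisymm (hmax t) ht
  have := hconst.deriv.deriv_eq
  simp only [deriv_const'] at this
  exact h.ne' this

section Laplacian

variable {N : ℕ} {f g : EuclideanSpace ℝ (Fin N) → ℝ}

theorem contDiff_comp_line (hf : ContDiff ℝ 2 f) (x e : EuclideanSpace ℝ (Fin N)) :
    ContDiff ℝ 2 (fun t : ℝ => f (x + t • e)) :=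
  hf.comp (contDiff_const.add (contDiff_id.smul contDiff_const))

theorem iteratedDeriv_two_comp_line (hf : ContDiff ℝ 2 f) (x e : EuclideanSpace ℝ (Fin N)) :
    iteratedDeriv 2 (fun t : ℝ => f (x + t • e)) 0 =
      fderiv ℝ (fun z => fderiv ℝ f z e) x e := by
  have key : ∀ {h : EuclideanSpace ℝ (Fin N) → ℝ}, Differentiable ℝ h → ∀ t : ℝ,
      deriv (fun t : ℝ => h (x + t • e)) t = fderiv ℝ h (x + t • e) e := by
    intro h hh t
    have hl : HasDerivAt (fun t : ℝ => x + t • e) e t := by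
      simpa using ((hasDerivAt_id t).smul_const e).const_add x
    exact ((hh (x + t • e)).hasFDerivAt.comp_hasDerivAt t hl).deriv
  have hd : Differentiable ℝ (fun z => fderiv ℝ f z e) :=
    ((hf.fderiv_right (m := 1) (by norm_num)).clm_apply contDiff_const).differentiable
      (by norm_num)
  rw [iteratedDeriv_succ, iteratedDeriv_one, funext (key (hf.differentiable (by norm_num))),
    key hd]
  simp

theorem lap_add (hf : ContDiff ℝ 2 f) (hg : ContDiff ℝ 2 g) (x : EuclideanSpace ℝ (Fin N)) :
    lap (fun z => f z + g z) x = lap f x + lap g x := by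
  unfold lap
  rw [← Finset.sum_add_distrib]
  refine Finset.sum_congr rfl fun i _ => ?_
  exact iteratedDeriv_fun_add (contDiff_comp_line hf x _).contDiffAt
    (contDiff_comp_line hg x _).contDiffAt

theorem lap_const_mul (c : ℝ) (f : EuclideanSpace ℝ (Fin N) → ℝ)
    (x : EuclideanSpace ℝ (Fin N)) :
    lap (fun z => c * f z) x = c * lap f x := by
  unfold lap
  rw [Finset.mul_sum]
  refine Finset.sum_congr rfl fun i _ => ?_
  simp [iteratedDeriv_succ]

theorem lap_norm_sub_sq (x y : EuclideanSpace ℝ (Fin N)) :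
    lap (fun z => ‖z - y‖ ^ 2) x = 2 * N := by
  have h : ∀ i : Fin N, iteratedDeriv 2
      (fun t : ℝ => ‖x + t • EuclideanSpace.single i (1 : ℝ) - y‖ ^ 2) 0 = 2 := by
    intro i
    have hexp : (fun t : ℝ => ‖x + t • EuclideanSpace.single i (1 : ℝ) - y‖ ^ 2) =
        fun t : ℝ => ‖x - y‖ ^ 2 + t * (2 * inner ℝ (x - y) (EuclideanSpace.single i (1 : ℝ)))
          + t ^ 2 := by
      funext t
      rw [add_sub_right_comm, norm_add_sq_real, real_inner_smul_right, norm_smul]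
      simp
      ring
    have hderiv : deriv (fun t : ℝ => ‖x - y‖ ^ 2 +
        t * (2 * inner ℝ (x - y) (EuclideanSpace.single i (1 : ℝ))) + t ^ 2) =
        fun t => 2 * inner ℝ (x - y) (EuclideanSpace.single i (1 : ℝ)) + 2 * t := by
      funext t
      have h1 := ((hasDerivAt_id t).mul_const
        (2 * inner ℝ (x - y) (EuclideanSpace.single i (1 : ℝ)))).const_add (‖x - y‖ ^ 2)
      have h2 := h1.add (hasDerivAt_pow 2 t)
      exact h2.deriv.trans (by simp)
    rw [hexp, iteratedDeriv_succ, iteratedDeriv_one, hderiv]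
    simp
  unfold lap
  simp [h, mul_comm]

theorem lap_nonpos_of_forall_le (hf : ContDiff ℝ 2 f) {x : EuclideanSpace ℝ (Fin N)}
    (hmax : ∀ z, f z ≤ f x) : lap f x ≤ 0 := by
  refine Finset.sum_nonpos fun i _ => ?_
  refine iteratedDeriv_two_nonpos_of_forall_le (contDiff_comp_line hf x _).continuous fun t => ?_
  simpa using hmax _

theorem HasBoundedDerivs.lap {n : ℕ} (hf : HasBoundedDerivs (n + 2) f) :
    HasBoundedDerivs n (lap f) := by
  have h2 : ContDiff ℝ 2 f := hf.1.of_le (by norm_cast; omega)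
  have heq : _root_.lap f = fun x => ∑ i : Fin N,
      fderiv ℝ (fun z => fderiv ℝ f z (EuclideanSpace.single i (1 : ℝ))) x
        (EuclideanSpace.single i (1 : ℝ)) :=
    funext fun x => Finset.sum_congr rfl fun i _ => iteratedDeriv_two_comp_line h2 x _
  rw [heq]
  exact HasBoundedDerivs.sum _ fun i _ =>
    (HasBoundedDerivs.fderiv_apply (n := n + 1) hf _).fderiv_apply _

theorem HasBoundedDerivs.iterate_lap {n : ℕ} (k : ℕ) (hf : HasBoundedDerivs (n + 2 * k) f) :
    HasBoundedDerivs n (_root_.lap^[k] f) := by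
  induction k generalizing f with
  | zero => exact hf
  | succ k ih => exact ih (HasBoundedDerivs.lap hf)

/-- A bounded function `f` with `-Δf = g` and `g` bounded and superharmonic has `g ≥ 0`. -/
theorem nonneg_of_neg_lap_eq {A B : ℝ} (hf : ContDiff ℝ 2 f) (hg : ContDiff ℝ 2 g)
    (hfA : ∀ x, |f x| ≤ A) (hgB : ∀ x, |g x| ≤ B) (hfg : ∀ x, lap f x = -g x)
    (hlap : ∀ x, lap g x ≤ 0) (y : EuclideanSpace ℝ (Fin N)) : 0 ≤ g y := by
  by_contra! hy
  have hA : 0 ≤ A := (abs_nonneg _).trans (hfA y)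
  obtain ⟨ε, hε, hεA⟩ : ∃ ε : ℝ, 0 < ε ∧ 2 * ε * A < -g y / 2 := by
    refine ⟨-g y / (8 * (A + 1)), by apply div_pos <;> linarith, ?_⟩
    rw [show 2 * (-g y / (8 * (A + 1))) * A = -g y / 4 * (A / (A + 1)) by field_simp; ring]
    have : A / (A + 1) ≤ 1 := (div_le_one (by linarith)).2 (by linarith)
    nlinarith
  obtain ⟨η, hη, hηN⟩ : ∃ η : ℝ, 0 < η ∧ η * (2 * N) < ε * (-g y / 2) := by
    have hpos : 0 < ε * (-g y / 2) := mul_pos hε (by linarith)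
    have hN : (0 : ℝ) ≤ N := N.cast_nonneg
    refine ⟨ε * (-g y / 2) / (2 * N + 1), by positivity, ?_⟩
    rw [div_mul_eq_mul_div, div_lt_iff₀ (by linarith)]
    nlinarith
  let F : EuclideanSpace ℝ (Fin N) → ℝ :=
    fun z => ((-1) * g z + ε * f z) + (-η) * ‖z - y‖ ^ 2
  have hsq : ContDiff ℝ 2 fun z : EuclideanSpace ℝ (Fin N) => ‖z - y‖ ^ 2 :=
    (contDiff_id.sub contDiff_const).norm_sq ℝ
  have hF₁ : ContDiff ℝ 2 fun z => (-1) * g z + ε * f z :=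
    (contDiff_const.mul hg).add (contDiff_const.mul hf)
  have hF : ContDiff ℝ 2 F := hF₁.add (contDiff_const.mul hsq)
  have hlim : Filter.Tendsto F (Filter.cocompact _) Filter.atBot := by
    have hnorm : Filter.Tendsto (fun z : EuclideanSpace ℝ (Fin N) => ‖z - y‖ ^ 2)
        (Filter.cocompact _) Filter.atTop := by
      refine (Filter.tendsto_pow_atTop two_ne_zero).comp ?_
      simpa [dist_eq_norm] using tendsto_dist_right_cocompact_atTop y
    refine Filter.tendsto_atBot_add_left_of_ge _ (B + ε * A) (fun z => ?_)
      (hnorm.const_mul_atTop_of_neg (neg_lt_zero.2 hη))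
    have h1 := (abs_le.1 (hgB z)).1
    have h2 := mul_le_mul_of_nonneg_left (abs_le.1 (hfA z)).2 hε.le
    linarith
  obtain ⟨x, hx⟩ := hF.continuous.exists_forall_ge hlim
  have hFx : F y ≤ F x := hx y
  have hgx : -g y / 2 < -g x := by
    have h1 := mul_le_mul_of_nonneg_left (abs_le.1 (hfA x)).2 hε.le
    have h2 := mul_le_mul_of_nonneg_left (abs_le.1 (hfA y)).1 hε.le
    have h3 : 0 ≤ η * ‖x - y‖ ^ 2 := by positivity
    simp only [F, sub_self, norm_zero] at hFx
    linarith
  have hlapF : lap F x = -lap g x + ε * -g x - η * (2 * N) := by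
    rw [lap_add hF₁ (contDiff_const.mul hsq), lap_add (contDiff_const.mul hg)
      (contDiff_const.mul hf), lap_const_mul, lap_const_mul, lap_const_mul, lap_norm_sub_sq, hfg]
    ring
  have hle := lap_nonpos_of_forall_le hF hx
  have hgap := mul_lt_mul_of_pos_left hgx hε
  linarith [hlap x]

theorem lap_polyLap (k : ℕ) (f : EuclideanSpace ℝ (Fin N) → ℝ)
    (x : EuclideanSpace ℝ (Fin N)) : lap (polyLap k f) x = -polyLap (k + 1) f x := by
  have h : polyLap k f = fun z => (-1 : ℝ) ^ k * lap^[k] f z := rfl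
  rw [h, lap_const_mul, polyLap, Function.iterate_succ_apply']
  ring

end Laplacian

/-- If `g : ℝ → ℝ` is convex and nonnegative, then for every classical bounded solution
`v` of `(-Δ)^m v = g(v)` in `ℝ^N` (with all partial derivatives of order `≤ 2m` bounded)
one has `(-Δ)^l v ≥ 0` on `ℝ^N` for every `l = 1, …, m-1`. -/
theorem stmt_16 {N m : ℕ} (hN : 0 < N) (hm : 2 ≤ m) (g : ℝ → ℝ)
    (hg_conv : ConvexOn ℝ Set.univ g)
    (hg_nonneg : ∀ s : ℝ, 0 ≤ g s)
    (v : EuclideanSpace ℝ (Fin N) → ℝ)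
    (hv : ContDiff ℝ (2 * m : ℕ) v)
    (hbdd : ∀ j : ℕ, j ≤ 2 * m → ∃ C : ℝ, ∀ x : EuclideanSpace ℝ (Fin N),
      ‖iteratedFDeriv ℝ j v x‖ ≤ C)
    (heq : ∀ x : EuclideanSpace ℝ (Fin N), polyLap m v x = g (v x)) :
    ∀ l : ℕ, 1 ≤ l → l < m → ∀ x : EuclideanSpace ℝ (Fin N), 0 ≤ polyLap l v x := by
  have hB : HasBoundedDerivs (2 * m) v := ⟨hv, hbdd⟩
  have hreg : ∀ k < m, ContDiff ℝ 2 (polyLap k v) ∧ ∃ C : ℝ, ∀ x, |polyLap k v x| ≤ C := by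
    intro k hk
    have hk' : HasBoundedDerivs (2 * m - 2 * k) (lap^[k] v) :=
      HasBoundedDerivs.iterate_lap k (by rwa [Nat.sub_add_cancel (by omega)])
    refine ⟨contDiff_const.mul (hk'.1.of_le (by norm_cast; omega)), ?_⟩
    simpa [polyLap, abs_mul] using hk'.exists_abs_le
  have hstep : ∀ k, k + 1 < m → (∀ x, 0 ≤ polyLap (k + 2) v x) →
      ∀ x, 0 ≤ polyLap (k + 1) v x := by
    intro k hk hnonneg
    obtain ⟨hf, A, hA⟩ := hreg k (by omega)
    obtain ⟨hg, B, hB⟩ := hreg (k + 1) hk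
    refine nonneg_of_neg_lap_eq hf hg hA hB (lap_polyLap k v) fun x => ?_
    rw [lap_polyLap]
    exact neg_nonpos.2 (hnonneg x)
  have hdown : ∀ d l : ℕ, 1 ≤ l → l + d = m → ∀ x, 0 ≤ polyLap l v x := by
    intro d
    induction d with
    | zero =>
      rintro l - rfl x
      exact (hg_nonneg _).trans_eq (heq x).symm
    | succ d ih =>
      intro l hl hlm
      obtain ⟨k, rfl⟩ := Nat.exists_eq_add_of_le' hl
      exact hstep k (by omega) (ih (k + 2) (by omega) (by omega))
  intro l hl hlm
  exact hdown (m - l) l hl (by omega)
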